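/- Principal value representation of the Loewner kernel: for every r > 0 and every z ∈ ℂ ∖ L_r, the symmetric limit −i·lim_{N→∞} ∑_{n=−N}^{N} (e^{2nr} + e^{iz})/(e^{2nr} − e^{iz}) exists and equals 2 Θ′(r,z)/Θ(r,z). -/

import Mathlib

open Complex

/-- The theta function Θ(r,z) = (1/i)·∑_{n∈ℤ} (−1)^n e^{−r(n+1/2)²} e^{(n+1/2)iz}. -/
noncomputable def Theta (r : ℝ) (z : ℂ) : ℂ :=
  (1 / Complex.I) * ∑' n : ℤ, (-1 : ℂ) ^ n *
    Complex.exp (-(r : ℂ) * ((n : ℂ) + 1 / 2) ^ 2) *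
    Complex.exp (((n : ℂ) + 1 / 2) * Complex.I * z)

/-- The Loewner kernel H(r,z) = 2 Θ′(r,z)/Θ(r,z). -/
noncomputable def Hker (r : ℝ) (z : ℂ) : ℂ := 2 * deriv (Theta r) z / Theta r z

/-- The lattice L_r = 2πℤ + 2irℤ. -/
def ThetaLattice (r : ℝ) : Set ℂ :=
  {z | ∃ m n : ℤ, z = 2 * (Real.pi : ℂ) * m + 2 * Complex.I * r * n}

/-- Lattice point 2πm + 2irn. -/
noncomputable def latPt (r : ℝ) (p : ℤ × ℤ) : ℂ :=
  2 * (Real.pi : ℂ) * p.1 + 2 * Complex.I * (r : ℂ) * p.2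

/-- The Weierstrass zeta function with periods (2π, 2ir). -/
noncomputable def wzeta (r : ℝ) (z : ℂ) : ℂ :=
  1 / z + ∑' p : ℤ × ℤ, if p = 0 then 0 else
    (1 / (z - latPt r p) + 1 / latPt r p + z / latPt r p ^ 2)


/-- Euler products. -/
noncomputable def eulE (Q : ℝ) (m : ℕ) : ℝ := ∏ j ∈ Finset.range m, (1 - Q ^ (j + 1))

/-- Gaussian binomial coefficients. -/
noncomputable def gaussB (Q : ℝ) : ℕ → ℕ → ℝ
  | _, 0 => 1
  | 0, _ + 1 => 0
  | m + 1, k + 1 => gaussB Q m k + Q ^ (k + 1) * gaussB Q m (k + 1)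

lemma gaussB_zero (Q : ℝ) (m : ℕ) : gaussB Q m 0 = 1 := by cases m <;> rfl

lemma gaussB_lt (Q : ℝ) (m : ℕ) : ∀ k, m < k → gaussB Q m k = 0 := by
  induction m with
  | zero => intro k hk; cases k with
    | zero => omega
    | succ k => rfl
  | succ m ih => intro k hk; cases k with
    | zero => omega
    | succ k => rw [gaussB, ih k (by omega), ih (k+1) (by omega)]; ring

lemma eulE_succ (Q : ℝ) (m : ℕ) : eulE Q (m + 1) = eulE Q m * (1 - Q ^ (m + 1)) := by
  simp [eulE, Finset.prod_range_succ]

lemma gaussB_mul (Q : ℝ) (m : ℕ) : ∀ a b, a + b = m →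
    gaussB Q m a * (eulE Q a * eulE Q b) = eulE Q m := by
  induction m with
  | zero =>
    intro a b h
    obtain rfl : a = 0 := by omega
    obtain rfl : b = 0 := by omega
    simp [gaussB, eulE]
  | succ m ih =>
    intro a b h
    cases a with
    | zero =>
      obtain rfl : b = m + 1 := by omega
      simp [gaussB_zero, eulE]
    | succ a =>
      rw [gaussB]
      cases b with
      | zero =>
        obtain rfl : a = m := by omega
        rw [gaussB_lt Q a (a + 1) (by omega)]
        have := ih a 0 (by omega)
        rw [eulE_succ]
        linear_combination (1 - Q ^ (a + 1)) * this
      | succ b =>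
        have h1 := ih a (b + 1) (by omega)
        have h2 := ih (a + 1) b (by omega)
        obtain rfl : m = a + b + 1 := by omega
        rw [eulE_succ Q (a + b + 1)]
        rw [eulE_succ] at h1 h2 ⊢
        rw [eulE_succ Q b]
        linear_combination (1 - Q ^ (a + 1)) * h1 + Q ^ (a + 1) * (1 - Q ^ (b + 1)) * h2

lemma cauchy_binom (Q : ℝ) (m : ℕ) : ∀ x : ℂ, ∏ j ∈ Finset.range m, (1 + x * (Q : ℂ) ^ j) =
    ∑ k ∈ Finset.range (m + 1), (Q : ℂ) ^ (k.choose 2) * (gaussB Q m k : ℂ) * x ^ k := by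
  induction m with
  | zero => intro x; simp [gaussB]
  | succ m ih =>
    intro x
    rw [Finset.prod_range_succ']
    have h1 : ∀ j, (1 + x * (Q : ℂ) ^ (j + 1)) = 1 + (x * Q) * (Q : ℂ) ^ j := by
      intro j; ring
    simp_rw [h1]
    rw [ih (x * Q)]
    have h2 : ∑ k ∈ Finset.range (m + 1), (Q : ℂ) ^ (k.choose 2) * (gaussB Q m k : ℂ) * (x * Q) ^ k
      = ∑ k ∈ Finset.range (m + 1),
        (Q : ℂ) ^ ((k + 1).choose 2) * (Q : ℂ) ^ (k + 1) * (gaussB Q m (k + 1) : ℂ) * x ^ (k + 1)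
        + 1 := by
      have := Finset.sum_range_succ (fun k => (Q : ℂ) ^ (k.choose 2) * (gaussB Q m k : ℂ) * (x * Q) ^ k) (m + 1)
      rw [gaussB_lt Q m (m + 1) (by omega)] at this
      simp only [ofReal_zero, mul_zero, zero_mul, add_zero] at this
      rw [← this, Finset.sum_range_succ']
      congr 1
      · refine Finset.sum_congr rfl fun k _ => ?_
        ring
      · simp [gaussB_zero]
    rw [Finset.sum_range_succ' _ (m + 1)]
    simp only [gaussB_zero]
    rw [pow_zero, mul_one, mul_add, mul_one]
    nth_rewrite 1 [h2]
    rw [Finset.sum_mul]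
    have h3 : ∀ k, (Q : ℂ) ^ ((k + 1).choose 2) = (Q : ℂ) ^ (k.choose 2) * (Q : ℂ) ^ k := by
      intro k
      rw [Nat.choose_succ_succ' k 1, Nat.choose_one_right, pow_add]; ring
    rw [add_right_comm, ← Finset.sum_add_distrib]
    simp only [Nat.choose_zero_succ, pow_zero, ofReal_one, mul_one]
    congr 1
    refine Finset.sum_congr rfl fun k _ => ?_
    rw [gaussB, h3]
    push_cast
    ring

lemma sum_sq_pow_summable {Q : ℝ} (h0 : 0 < Q) (h1 : Q < 1) (c : ℂ) :
    Summable fun n : ℕ => ‖-(c * (Q : ℂ) ^ (n + 1))‖ := by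
  have : Summable fun n : ℕ => ‖c‖ * Q * Q ^ n :=
    (summable_geometric_of_lt_one h0.le h1).mul_left _
  refine this.congr fun n => ?_
  rw [norm_neg, norm_mul, norm_pow, Complex.norm_real, Real.norm_of_nonneg h0.le]; ring

lemma prod_tendsto {Q : ℝ} (h0 : 0 < Q) (h1 : Q < 1) (c : ℂ)
    (hc : ∀ n : ℕ, 1 - c * (Q : ℂ) ^ (n + 1) ≠ 0) :
    ∃ L : ℂ, L ≠ 0 ∧ Filter.Tendsto (fun N => ∏ n ∈ Finset.range N, (1 - c * (Q : ℂ) ^ (n + 1)))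
      Filter.atTop (nhds L) := by
  have hs := sum_sq_pow_summable h0 h1 c
  refine ⟨∏' n : ℕ, (1 + -(c * (Q : ℂ) ^ (n + 1))), ?_, ?_⟩
  · apply tprod_one_add_ne_zero_of_summable _ hs
    intro n; rw [← sub_eq_add_neg]; exact hc n
  · simp only [sub_eq_add_neg]
    exact (multipliable_one_add_of_summable hs).hasProd.tendsto_prod_nat

lemma eulE_pos {Q : ℝ} (h0 : 0 < Q) (h1 : Q < 1) (m : ℕ) : 0 < eulE Q m :=
  Finset.prod_pos fun j _ => by
    have := pow_lt_one₀ h0.le h1 (n := j + 1) (by omega)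
    linarith

lemma eulE_anti {Q : ℝ} (h0 : 0 < Q) (h1 : Q < 1) : Antitone (eulE Q) := by
  refine antitone_nat_of_succ_le fun m => ?_
  rw [eulE_succ]
  have := pow_pos h0 (m + 1)
  nlinarith [eulE_pos h0 h1 m]

lemma eulE_lim {Q : ℝ} (h0 : 0 < Q) (h1 : Q < 1) : ∃ L : ℝ, 0 < L ∧ (∀ m, L ≤ eulE Q m) ∧
    Filter.Tendsto (eulE Q) Filter.atTop (nhds L) := by
  obtain ⟨L, hL, hl⟩ := prod_tendsto h0 h1 1 (by
    intro n
    have := pow_lt_one₀ h0.le h1 (n := n + 1) (by omega)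
    rw [one_mul]; norm_cast; linarith)
  have hb : BddBelow (Set.range (eulE Q)) := ⟨0, by rintro _ ⟨m, rfl⟩; exact (eulE_pos h0 h1 m).le⟩
  have ht := tendsto_atTop_ciInf (eulE_anti h0 h1) hb
  have h2 : Filter.Tendsto (fun m => (eulE Q m : ℂ)) Filter.atTop (nhds ((⨅ i, eulE Q i : ℝ) : ℂ)) :=
    (Complex.continuous_ofReal.tendsto _).comp ht
  have h3 : L = ((⨅ i, eulE Q i : ℝ) : ℂ) := by
    refine tendsto_nhds_unique hl (h2.congr fun m => ?_)
    simp [eulE]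
  refine ⟨⨅ i, eulE Q i, ?_, fun m => ciInf_le hb m, ht⟩
  refine lt_of_le_of_ne (le_ciInf fun m => (eulE_pos h0 h1 m).le) ?_
  intro h
  rw [← h] at h3
  exact hL (by simpa using h3)

/-- bilateral coefficients -/
noncomputable def bcoef (Q : ℝ) (N : ℕ) (n : ℤ) : ℝ :=
  if -(N : ℤ) - 1 ≤ n then gaussB Q (2 * N + 1) (n + N + 1).toNat else 0

lemma bcoef_eq {Q : ℝ} (h0 : 0 < Q) (h1 : Q < 1) (N : ℕ) (n : ℤ) (ha : -(N : ℤ) - 1 ≤ n) (hb : n ≤ N) :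
    bcoef Q N n = eulE Q (2 * N + 1) / (eulE Q (n + N + 1).toNat * eulE Q (N - n).toNat) := by
  rw [bcoef, if_pos ha, eq_div_iff]
  · exact gaussB_mul Q _ _ _ (by omega)
  · exact (mul_pos (eulE_pos h0 h1 _) (eulE_pos h0 h1 _)).ne'

lemma bcoef_out (Q : ℝ) (N : ℕ) (n : ℤ) (h : ¬ (-(N : ℤ) - 1 ≤ n ∧ n ≤ N)) : bcoef Q N n = 0 := by
  rw [bcoef]
  split_ifs with h'
  · exact gaussB_lt _ _ _ (by omega)
  · rfl

lemma bcoef_tendsto {Q : ℝ} (h0 : 0 < Q) (h1 : Q < 1) {f : ℤ → ℂ} (hf : Summable f) :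
    Filter.Tendsto (fun N : ℕ => ∑' n : ℤ, (bcoef Q N n : ℂ) * f n) Filter.atTop
      (nhds (((Classical.choose (eulE_lim h0 h1) : ℝ) : ℂ)⁻¹ * ∑' n, f n)) := by
  obtain ⟨hL, hle, hl⟩ := Classical.choose_spec (eulE_lim h0 h1)
  set L := Classical.choose (eulE_lim h0 h1)
  rw [← tsum_mul_left]
  refine tendsto_tsum_of_dominated_convergence (bound := fun n => (1 / (L * L)) * ‖f n‖)
    (hf.norm.mul_left _) ?_ ?_
  · intro n
    refine Filter.Tendsto.mul_const _ ?_
    have key : Filter.Tendsto (fun N : ℕ => bcoef Q N n) Filter.atTop (nhds L⁻¹) := by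
      have : Filter.Tendsto (fun N : ℕ => eulE Q (2 * N + 1) / (eulE Q (n + N + 1).toNat * eulE Q (N - n).toNat))
          Filter.atTop (nhds (L / (L * L))) := by
        refine Filter.Tendsto.div (hl.comp ?_) (Filter.Tendsto.mul (hl.comp ?_) (hl.comp ?_)) (by positivity)
        · exact Filter.tendsto_atTop_mono (fun N => by show N ≤ 2 * N + 1; omega) Filter.tendsto_id
        · refine Filter.tendsto_atTop.2 fun b => ?_
          filter_upwards [Filter.eventually_ge_atTop (b + n.natAbs)] with N hN
          omega
        · refine Filter.tendsto_atTop.2 fun b => ?_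
          filter_upwards [Filter.eventually_ge_atTop (b + n.natAbs)] with N hN
          omega
      have e : L / (L * L) = L⁻¹ := by field_simp
      rw [e] at this
      refine this.congr' ?_
      filter_upwards [Filter.eventually_ge_atTop (n.natAbs)] with N hN
      rw [bcoef_eq h0 h1 _ _ (by omega) (by omega)]
    have := (Complex.continuous_ofReal.tendsto _).comp key
    simpa [Function.comp_def] using this
  · refine Filter.Eventually.of_forall fun N n => ?_
    rw [norm_mul]
    refine mul_le_mul_of_nonneg_right ?_ (norm_nonneg _)
    rw [Complex.norm_real]
    by_cases h : -(N : ℤ) - 1 ≤ n ∧ n ≤ N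
    · rw [bcoef_eq h0 h1 _ _ h.1 h.2, Real.norm_of_nonneg (by
        have := eulE_pos h0 h1; exact div_nonneg (this _).le (mul_pos (this _) (this _)).le)]
      have e1 : eulE Q (2 * N + 1) ≤ 1 := by
        have := eulE_anti h0 h1 (Nat.zero_le (2 * N + 1))
        simpa [eulE] using this
      exact div_le_div₀ zero_le_one e1 (mul_pos hL hL)
        (mul_le_mul (hle _) (hle _) hL.le (eulE_pos h0 h1 _).le)
    · rw [bcoef_out _ _ _ h]; simp; positivity

/-- Summand of the theta series. -/
noncomputable def tht (r : ℝ) (n : ℤ) (z : ℂ) : ℂ := (-1 : ℂ) ^ n *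
    Complex.exp (-(r : ℂ) * ((n : ℂ) + 1 / 2) ^ 2) *
    Complex.exp (((n : ℂ) + 1 / 2) * Complex.I * z)

lemma prod_range_Icc (f : ℤ → ℂ) (N : ℕ) :
    ∏ j ∈ Finset.range (2 * N + 1), f ((j : ℤ) - N) = ∏ n ∈ Finset.Icc (-(N : ℤ)) N, f n := by
  refine Finset.prod_bij' (fun j _ => (j : ℤ) - N) (fun n _ => (n + N).toNat) ?_ ?_ ?_ ?_ ?_
  · intro a ha; simp at ha ⊢; omega
  · intro a ha; simp at ha ⊢; omega
  · intro a ha; simp at ha ⊢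
  · intro a ha; simp at ha ⊢; omega
  · intro a ha; rfl

lemma prod_Icc_split (f : ℤ → ℂ) (N : ℕ) :
    ∏ n ∈ Finset.Icc (-(N : ℤ)) N, f n =
      f 0 * ∏ n ∈ Finset.range N, (f ((n : ℤ) + 1) * f (-((n : ℤ) + 1))) := by
  induction N with
  | zero => simp
  | succ N ih =>
    have : Finset.Icc (-((N + 1 : ℕ) : ℤ)) ((N + 1 : ℕ) : ℤ) =
        insert ((N : ℤ) + 1) (insert (-((N : ℤ) + 1)) (Finset.Icc (-(N : ℤ)) N)) := by
      ext x; simp; omega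
    rw [this, Finset.prod_insert (by simp; omega), Finset.prod_insert (by simp), ih,
      Finset.prod_range_succ]
    ring

/-- normalising constant -/
noncomputable def cN (r : ℝ) (N : ℕ) : ℂ := (-1) ^ (N + 1) * Complex.exp (-(r : ℂ) * ((N : ℂ) + 1 / 2) ^ 2)

lemma finite_triple (r : ℝ) (N : ℕ) (z : ℂ) :
    ∑ n ∈ Finset.Icc (-(N : ℤ) - 1) N, (bcoef (Real.exp (-2 * r)) N n : ℂ) * tht r n z =
      cN r N * (Complex.exp (-((N : ℂ) + 1 / 2) * Complex.I * z) *
        ∏ n ∈ Finset.Icc (-(N : ℤ)) N, (1 - Complex.exp (-2 * (n : ℂ) * r) * Complex.exp (Complex.I * z))) := by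
  rw [← prod_range_Icc (fun n => 1 - Complex.exp (-2 * (n : ℂ) * r) * Complex.exp (Complex.I * z))]
  have h1 : ∀ j : ℕ, 1 - Complex.exp (-2 * (((j : ℤ) - (N : ℤ) : ℤ) : ℂ) * r) * Complex.exp (Complex.I * z)
      = 1 + (-(Complex.exp (2 * N * r) * Complex.exp (Complex.I * z))) * ((Real.exp (-2 * r) : ℝ) : ℂ) ^ j := by
    intro j
    rw [Complex.ofReal_exp, ← Complex.exp_nat_mul, ← Complex.exp_add, neg_mul _ (Complex.exp (↑j * _)), ← Complex.exp_add,
      ← Complex.exp_add, sub_eq_add_neg]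
    congr 3
    push_cast; ring
  simp_rw [h1]
  rw [cauchy_binom, ← mul_assoc, Finset.mul_sum]
  symm
  refine Finset.sum_bij' (fun k _ => (k : ℤ) - N - 1) (fun n _ => (n + N + 1).toNat) ?_ ?_ ?_ ?_ ?_
  · intro a ha; simp at ha ⊢; omega
  · intro a ha; simp at ha ⊢; omega
  · intro a ha; simp at ha ⊢; omega
  · intro a ha; simp at ha ⊢; omega
  · intro k hk
    have e1 : bcoef (Real.exp (-2 * r)) N ((k : ℤ) - N - 1) = gaussB (Real.exp (-2 * r)) (2 * N + 1) k := by
      rw [bcoef, if_pos (by omega)]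
      congr 1; omega
    rw [e1, tht, cN, neg_pow (Complex.exp _ * _), Complex.ofReal_exp, ← Complex.exp_nat_mul, Nat.cast_choose_two, ← Complex.exp_add,
      ← Complex.exp_nat_mul]
    have e2 : (-1 : ℂ) ^ ((k : ℤ) - N - 1) = (-1) ^ (N + 1) * (-1) ^ k := by
      rw [show ((k : ℤ) - N - 1) = ((N + 1 : ℕ) : ℤ) + (k : ℤ) - 2 * ((N + 1 : ℕ) : ℤ) by push_cast; ring,
        zpow_sub₀ (by norm_num), zpow_add₀ (by norm_num), zpow_mul, zpow_natCast, zpow_natCast]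
      norm_num
    rw [e2]
    have e3 : Complex.exp (-(r : ℂ) * ((((k : ℤ) - N - 1 : ℤ) : ℂ) + 1 / 2) ^ 2) *
        Complex.exp (((((k : ℤ) - N - 1 : ℤ) : ℂ) + 1 / 2) * Complex.I * z) =
        Complex.exp (-(r : ℂ) * ((N : ℂ) + 1 / 2) ^ 2) * Complex.exp (-((N : ℂ) + 1 / 2) * Complex.I * z) *
        Complex.exp ((k : ℂ) * ((k : ℂ) - 1) / 2 * ((-2 * r : ℝ) : ℂ)) *
        Complex.exp ((k : ℂ) * (2 * N * r + Complex.I * z)) := by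
      simp only [← Complex.exp_add]
      congr 1
      push_cast
      ring
    linear_combination (-((-1) ^ (N + 1) * (-1) ^ k) * (gaussB (Real.exp (-2 * r)) (2 * N + 1) k : ℂ)) * e3

lemma tht_eq (r : ℝ) (n : ℤ) (z : ℂ) : tht r n z = Complex.exp (-(r : ℂ) / 4 + Complex.I * z / 2) *
    jacobiTheta₂_term n (1 / 2 + z / (2 * Real.pi) + Complex.I * r / (2 * Real.pi))
      (Complex.I * r / Real.pi) := by
  have hpi : (Real.pi : ℂ) ≠ 0 := by exact_mod_cast Real.pi_ne_zero
  rw [tht, jacobiTheta₂_term, ← Complex.exp_pi_mul_I, ← Complex.exp_int_mul]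
  simp only [← Complex.exp_add]
  congr 1
  field_simp
  ring_nf
  simp only [Complex.I_sq]
  ring

lemma tht_hasDerivAt (r : ℝ) (n : ℤ) (z : ℂ) :
    HasDerivAt (tht r n) (((n : ℂ) + 1 / 2) * Complex.I * tht r n z) z := by
  unfold tht
  have h := ((hasDerivAt_id z).const_mul (((n : ℂ) + 1 / 2) * Complex.I)).cexp.const_mul
    ((-1 : ℂ) ^ n * Complex.exp (-(r : ℂ) * ((n : ℂ) + 1 / 2) ^ 2))
  refine h.congr_deriv ?_
  simp only [id]
  ring

lemma tau_im {r : ℝ} (hr : 0 < r) : 0 < (Complex.I * r / Real.pi : ℂ).im := by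
  have : (Complex.I * r / Real.pi : ℂ) = ((r / Real.pi : ℝ) : ℂ) * Complex.I := by push_cast; ring
  rw [this]
  simp
  positivity

lemma tht_summable {r : ℝ} (hr : 0 < r) (z : ℂ) : Summable fun n => tht r n z := by
  simp_rw [tht_eq]
  exact ((summable_jacobiTheta₂_term_iff _ _).2 (tau_im hr)).mul_left _

lemma dtht_eq (r : ℝ) (n : ℤ) (z : ℂ) : ((n : ℂ) + 1 / 2) * Complex.I * tht r n z =
    Complex.exp (-(r : ℂ) / 4 + Complex.I * z / 2) * (Complex.I / 2) *
    jacobiTheta₂_term n (1 / 2 + z / (2 * Real.pi) + Complex.I * r / (2 * Real.pi))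
      (Complex.I * r / Real.pi) + Complex.exp (-(r : ℂ) / 4 + Complex.I * z / 2) * (1 / (2 * Real.pi)) *
    jacobiTheta₂'_term n (1 / 2 + z / (2 * Real.pi) + Complex.I * r / (2 * Real.pi))
      (Complex.I * r / Real.pi) := by
  have hpi : (Real.pi : ℂ) ≠ 0 := by exact_mod_cast Real.pi_ne_zero
  rw [tht_eq, jacobiTheta₂'_term]
  field_simp
  ring

theorem dtht_hasSum {r : ℝ} (hr : 0 < r) (z : ℂ) : HasSum (fun n : ℤ =>
    Complex.exp (-(r : ℂ) / 4 + Complex.I * z / 2) * (Complex.I / 2) *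
    jacobiTheta₂_term n (1 / 2 + z / (2 * Real.pi) + Complex.I * r / (2 * Real.pi))
      (Complex.I * r / Real.pi) + Complex.exp (-(r : ℂ) / 4 + Complex.I * z / 2) * (1 / (2 * Real.pi)) *
    jacobiTheta₂'_term n (1 / 2 + z / (2 * Real.pi) + Complex.I * r / (2 * Real.pi))
      (Complex.I * r / Real.pi))
    (Complex.exp (-(r : ℂ) / 4 + Complex.I * z / 2) * (Complex.I / 2) *
    jacobiTheta₂ (1 / 2 + z / (2 * Real.pi) + Complex.I * r / (2 * Real.pi))
      (Complex.I * r / Real.pi) + Complex.exp (-(r : ℂ) / 4 + Complex.I * z / 2) * (1 / (2 * Real.pi)) *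
    jacobiTheta₂' (1 / 2 + z / (2 * Real.pi) + Complex.I * r / (2 * Real.pi))
      (Complex.I * r / Real.pi)) :=
  ((hasSum_jacobiTheta₂_term (1 / 2 + z / (2 * Real.pi) + Complex.I * r / (2 * Real.pi)) (tau_im hr)).mul_left
    (Complex.exp (-(r : ℂ) / 4 + Complex.I * z / 2) * (Complex.I / 2))).add
  ((hasSum_jacobiTheta₂'_term (1 / 2 + z / (2 * Real.pi) + Complex.I * r / (2 * Real.pi)) (tau_im hr)).mul_left
    (Complex.exp (-(r : ℂ) / 4 + Complex.I * z / 2) * (1 / (2 * Real.pi))))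

lemma dtht_summable {r : ℝ} (hr : 0 < r) (z : ℂ) :
    Summable fun n : ℤ => ((n : ℂ) + 1 / 2) * Complex.I * tht r n z := by
  simp_rw [dtht_eq]
  exact (dtht_hasSum hr z).summable

lemma Theta_eq (r : ℝ) (z : ℂ) : Theta r z = 1 / Complex.I * ∑' n, tht r n z := rfl

lemma Theta_deriv {r : ℝ} (hr : 0 < r) (z : ℂ) :
    deriv (Theta r) z = 1 / Complex.I * ∑' n : ℤ, ((n : ℂ) + 1 / 2) * Complex.I * tht r n z := by
  have h1 : Theta r = fun z => 1 / Complex.I * (Complex.exp (-(r : ℂ) / 4 + Complex.I * z / 2) *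
      jacobiTheta₂ (1 / 2 + z / (2 * Real.pi) + Complex.I * r / (2 * Real.pi))
      (Complex.I * r / Real.pi)) := by
    ext w
    simp_rw [Theta_eq, jacobiTheta₂, tht_eq]
    rw [tsum_mul_left]
  simp_rw [dtht_eq]
  rw [(dtht_hasSum hr z).tsum_eq, h1]
  have hj := hasDerivAt_jacobiTheta₂_fst (1 / 2 + z / (2 * Real.pi) + Complex.I * r / (2 * Real.pi)) (tau_im hr)
  have hl : HasDerivAt (fun z : ℂ => 1 / 2 + z / (2 * Real.pi) + Complex.I * r / (2 * Real.pi))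
      (1 / (2 * Real.pi)) z := (((hasDerivAt_id z).div_const _).const_add _).add_const _
  have he : HasDerivAt (fun z : ℂ => Complex.exp (-(r : ℂ) / 4 + Complex.I * z / 2))
      (Complex.exp (-(r : ℂ) / 4 + Complex.I * z / 2) * (Complex.I * 1 / 2)) z :=
    ((((hasDerivAt_id z).const_mul _).div_const _).const_add _).cexp
  have hc := HasDerivAt.comp z hj hl
  refine ((he.mul hc).const_mul (1 / Complex.I)).deriv.trans ?_
  simp only [Function.comp]
  ring

lemma tsum_bcoef (Q : ℝ) (N : ℕ) (f : ℤ → ℂ) : ∑' n : ℤ, (bcoef Q N n : ℂ) * f n =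
    ∑ n ∈ Finset.Icc (-(N : ℤ) - 1) N, (bcoef Q N n : ℂ) * f n := by
  refine tsum_eq_sum fun n hn => ?_
  rw [bcoef_out, Complex.ofReal_zero, zero_mul]
  simpa using hn

lemma factor_ne {r : ℝ} {z : ℂ} (hz : z ∉ ThetaLattice r) (n : ℤ) :
    1 - Complex.exp (-2 * (n : ℂ) * r) * Complex.exp (Complex.I * z) ≠ 0 := by
  intro h
  apply hz
  rw [← Complex.exp_add, sub_eq_zero] at h
  obtain ⟨m, hm⟩ := Complex.exp_eq_one_iff.1 h.symm
  refine ⟨m, -n, ?_⟩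
  push_cast
  linear_combination (-Complex.I) * hm + (z - 2 * Real.pi * m) * Complex.I_sq

lemma theta_ne {r : ℝ} (hr : 0 < r) {z : ℂ} (hz : z ∉ ThetaLattice r) : ∑' n, tht r n z ≠ 0 := by
  have h0 : 0 < Real.exp (-2 * r) := Real.exp_pos _
  have h1 : Real.exp (-2 * r) < 1 := by rw [Real.exp_lt_one_iff]; linarith
  have ht := bcoef_tendsto h0 h1 (tht_summable hr z)
  have hq : ∀ n : ℕ, ((Real.exp (-2 * r) : ℝ) : ℂ) ^ (n + 1) = Complex.exp (-2 * ((n : ℂ) + 1) * r) := by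
    intro n
    rw [Complex.ofReal_exp, ← Complex.exp_nat_mul]; congr 1; push_cast; ring
  obtain ⟨A, hA, hA'⟩ := prod_tendsto h0 h1 (Complex.exp (Complex.I * z)) (by
    intro n
    have := factor_ne hz (n + 1)
    rw [hq, mul_comm]
    convert this using 5
    push_cast; ring)
  obtain ⟨B, hB, hB'⟩ := prod_tendsto h0 h1 (Complex.exp (-(Complex.I * z))) (by
    intro n h
    have := factor_ne hz (-(n + 1))
    apply this
    rw [hq, ← Complex.exp_add, sub_eq_zero] at h
    rw [← Complex.exp_add, sub_eq_zero, ← inv_inj, ← Complex.exp_neg, inv_one]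
    rw [h]; congr 1; push_cast; ring)
  have hlim := ((hA'.mul hB').const_mul
    (-Complex.exp (-(r : ℂ) / 4) * Complex.exp (-(Complex.I * z) / 2) * (1 - Complex.exp (Complex.I * z))))
  have heq := tendsto_nhds_unique ht (hlim.congr ?_)
  · intro h
    rw [h, mul_zero] at heq
    have h3 := factor_ne hz 0
    simp only [Int.cast_zero, mul_zero, zero_mul, Complex.exp_zero, one_mul] at h3
    have : -Complex.exp (-(r : ℂ) / 4) * Complex.exp (-(Complex.I * z) / 2) *
        (1 - Complex.exp (Complex.I * z)) * (A * B) ≠ 0 := by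
      refine mul_ne_zero (mul_ne_zero (mul_ne_zero (neg_ne_zero.2 (Complex.exp_ne_zero _)) (Complex.exp_ne_zero _)) h3)
        (mul_ne_zero hA hB)
    exact this heq.symm
  · intro N
    rw [tsum_bcoef, finite_triple, prod_Icc_split, ← Finset.prod_mul_distrib]
    induction N with
    | zero =>
      simp only [cN, Finset.range_zero, Finset.prod_empty, Int.cast_zero, mul_zero, zero_mul, Complex.exp_zero,
        one_mul, mul_one, Nat.cast_zero, zero_add, pow_one]
      rw [show -(r : ℂ) * (1 / 2) ^ 2 = -(r : ℂ) / 4 by ring,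
        show -(1 / 2 : ℂ) * Complex.I * z = -(Complex.I * z) / 2 by ring]
      ring
    | succ N ih =>
      rw [Finset.prod_range_succ, Finset.prod_range_succ, ← mul_assoc, ih, hq]
      have k1 : cN r (N + 1) = cN r N * (-Complex.exp (-2 * ((N : ℂ) + 1) * r)) := by
        rw [cN, cN, pow_succ (-1 : ℂ) (N + 1)]
        have : Complex.exp (-(r : ℂ) * (((N + 1 : ℕ) : ℂ) + 1 / 2) ^ 2) =
          Complex.exp (-(r : ℂ) * ((N : ℂ) + 1 / 2) ^ 2) * Complex.exp (-2 * ((N : ℂ) + 1) * r) := by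
          rw [← Complex.exp_add]; congr 1; push_cast; ring
        rw [this]; ring
      have k2 : Complex.exp (-(((N + 1 : ℕ) : ℂ) + 1 / 2) * Complex.I * z) =
          Complex.exp (-((N : ℂ) + 1 / 2) * Complex.I * z) * Complex.exp (-(Complex.I * z)) := by
        rw [← Complex.exp_add]; congr 1; push_cast; ring
      rw [k1, k2]
      have k3 : Complex.exp (-2 * (((-((N : ℤ) + 1) : ℤ)) : ℂ) * r) = (Complex.exp (-2 * ((N : ℂ) + 1) * r))⁻¹ := by
        rw [← Complex.exp_neg]; congr 1; push_cast; ring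
      have k4 : Complex.exp (-2 * ((((N : ℤ) + 1 : ℤ)) : ℂ) * r) = Complex.exp (-2 * ((N : ℂ) + 1) * r) := by
        congr 1; push_cast; ring
      rw [k3, k4, Complex.exp_neg (Complex.I * z)]
      have n1 := Complex.exp_ne_zero (-2 * ((N : ℂ) + 1) * r)
      have n2 := Complex.exp_ne_zero (Complex.I * z)
      generalize Complex.exp (-2 * ((N : ℂ) + 1) * r) = q at *
      generalize Complex.exp (Complex.I * z) = w at *
      generalize (∏ x ∈ Finset.range N, _ : ℂ) = P
      field_simp
      ring

/-- Principal value representation of the Loewner kernel. -/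
theorem H_principal_value (r : ℝ) (hr : 0 < r) (z : ℂ) (hz : z ∉ ThetaLattice r) :
    Filter.Tendsto (fun N : ℕ => -Complex.I *
        ∑ n ∈ Finset.Icc (-(N : ℤ)) (N : ℤ),
          (Complex.exp (2 * (n : ℂ) * (r : ℂ)) + Complex.exp (Complex.I * z)) /
          (Complex.exp (2 * (n : ℂ) * (r : ℂ)) - Complex.exp (Complex.I * z)))
      Filter.atTop (nhds (2 * deriv (Theta r) z / Theta r z)) := by
  
  have h0 : 0 < Real.exp (-2 * r) := Real.exp_pos _
  have h1 : Real.exp (-2 * r) < 1 := by rw [Real.exp_lt_one_iff]; linarith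
  have hne := theta_ne hr hz
  have ht := bcoef_tendsto h0 h1 (tht_summable hr z)
  have ht' := bcoef_tendsto h0 h1 (dtht_summable hr z)
  have hL : ((Classical.choose (eulE_lim h0 h1) : ℝ) : ℂ)⁻¹ ≠ 0 :=
    inv_ne_zero (Complex.ofReal_ne_zero.2 (Classical.choose_spec (eulE_lim h0 h1)).1.ne')
  have hd := (ht'.div ht (mul_ne_zero hL hne)).const_mul 2
  rw [mul_div_mul_left _ _ hL] at hd
  have hfin : 2 * deriv (Theta r) z / Theta r z =
      2 * ((∑' n : ℤ, ((n : ℂ) + 1 / 2) * Complex.I * tht r n z) / ∑' n, tht r n z) := by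
    rw [Theta_deriv hr, Theta_eq, mul_div_assoc, mul_div_mul_left _ _ (by simp)]
  rw [hfin]
  refine hd.congr fun N => ?_
  rw [Pi.div_apply, tsum_bcoef, tsum_bcoef]
  have hder : HasDerivAt (fun w => ∑ n ∈ Finset.Icc (-(N : ℤ) - 1) N,
      (bcoef (Real.exp (-2 * r)) N n : ℂ) * tht r n w)
      (∑ n ∈ Finset.Icc (-(N : ℤ) - 1) N, (bcoef (Real.exp (-2 * r)) N n : ℂ) *
        (((n : ℂ) + 1 / 2) * Complex.I * tht r n z)) z :=
    HasDerivAt.fun_sum fun n _ => (tht_hasDerivAt r n z).const_mul _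
  rw [← hder.deriv, ← logDeriv_apply (fun w => ∑ n ∈ Finset.Icc (-(N : ℤ) - 1) N,
      (bcoef (Real.exp (-2 * r)) N n : ℂ) * tht r n w)]
  simp_rw [finite_triple]
  have hcN : cN r N ≠ 0 := mul_ne_zero (pow_ne_zero _ (by norm_num)) (Complex.exp_ne_zero _)
  have hf : ∀ n : ℤ, HasDerivAt (fun w => 1 - Complex.exp (-2 * (n : ℂ) * r) * Complex.exp (Complex.I * w))
      (-(Complex.exp (-2 * (n : ℂ) * r) * (Complex.exp (Complex.I * z) * (Complex.I * 1)))) z := fun n =>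
    (((hasDerivAt_id z).const_mul Complex.I).cexp.const_mul _).const_sub 1
  have he : HasDerivAt (fun w => Complex.exp (-((N : ℂ) + 1 / 2) * Complex.I * w))
      (Complex.exp (-((N : ℂ) + 1 / 2) * Complex.I * z) * (-((N : ℂ) + 1 / 2) * Complex.I * 1)) z :=
    ((hasDerivAt_id z).const_mul _).cexp
  rw [logDeriv_const_mul _ _ hcN, logDeriv_mul (f := fun w => Complex.exp (-((N : ℂ) + 1 / 2) * Complex.I * w)) _ (Complex.exp_ne_zero _)
    (Finset.prod_ne_zero_iff.2 fun n _ => factor_ne hz n) he.differentiableAt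
    (DifferentiableAt.fun_finsetProd fun n _ => (hf n).differentiableAt),
    logDeriv_prod (fun n _ => factor_ne hz n) (fun n _ => (hf n).differentiableAt),
    logDeriv_apply, he.deriv, mul_div_cancel_left₀ _ (Complex.exp_ne_zero _)]
  simp_rw [logDeriv_apply, (hf _).deriv]
  have hcard : (-((N : ℂ) + 1 / 2) * Complex.I * 1) =
      ∑ n ∈ Finset.Icc (-(N : ℤ)) (N : ℤ), (-Complex.I / 2) := by
    rw [Finset.sum_const, Int.card_Icc, nsmul_eq_mul,
      show ((N : ℤ) + 1 - -(N : ℤ)).toNat = 2 * N + 1 by omega]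
    push_cast; ring
  rw [hcard, ← Finset.sum_add_distrib, Finset.mul_sum, Finset.mul_sum]
  refine Finset.sum_congr rfl fun n _ => ?_
  have hn := factor_ne hz n
  have e1 : Complex.exp (-2 * (n : ℂ) * r) = (Complex.exp (2 * (n : ℂ) * r))⁻¹ := by
    rw [← Complex.exp_neg]; congr 1; ring
  rw [e1] at hn ⊢
  have n1 := Complex.exp_ne_zero (2 * (n : ℂ) * r)
  generalize Complex.exp (2 * (n : ℂ) * r) = q at *
  generalize Complex.exp (Complex.I * z) = w at *
  have hn2 : q - w ≠ 0 := by
    intro h; apply hn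
    rw [sub_eq_zero] at h
    rw [← h, inv_mul_cancel₀ n1, sub_self]
  have e2 : 1 - q⁻¹ * w = (q - w) / q := by field_simp
  rw [e2]
  field_simp
  ring
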